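/- arXiv:1002.1359 — 6 statements merged into one kernel-verified Lean document; each statement's English description precedes it below -/
import Mathlib

section
/- Let p be a prime and let G be a finite p-group that is purely non-abelian, i.e., G has no non-trivial abelian direct factor (G cannot be written as an internal direct product A × B with A a non-trivial abelian group). Then the group Autcent(G) of all central automorphisms of G is a p-group. -/
/-- The subgroup of `MulAut G` consisting of central automorphisms, i.e. those
automorphisms `α` with `g⁻¹ * α g ∈ Z(G)` for all `g` (equivalently, those
commuting with every inner automorphism). -/
def centralAuts (G : Type*) [Group G] : Subgroup (MulAut G) where
  carrier := {α | ∀ g : G, g⁻¹ * α g ∈ Subgroup.center G}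
  one_mem' := fun g => by simpa using (Subgroup.center G).one_mem
  mul_mem' := fun {a b} ha hb g => by
    have h := mul_mem (hb g) (ha (b g))
    simpa [mul_assoc] using h
  inv_mem' := fun {a} ha g => by
    have h := inv_mem (ha (a⁻¹ g))
    simpa [mul_inv_rev] using h

/-- A group `G` is purely non-abelian if it admits no internal direct product
decomposition `G = A × B` with `A` a non-trivial abelian subgroup. -/
def PurelyNonAbelian (G : Type*) [Group G] : Prop :=
  ¬ ∃ A B : Subgroup G, A ≠ ⊥ ∧ (∀ a b : A, a * b = b * a) ∧
      (∀ a ∈ A, ∀ b ∈ B, a * b = b * a) ∧ A ⊓ B = ⊥ ∧ A ⊔ B = ⊤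

/-- Some positive power of an element of a finite monoid is idempotent. -/
lemma exists_pos_isIdempotentElem_pow {M : Type*} [Monoid M] [Finite M] (a : M) :
    ∃ n : ℕ, 0 < n ∧ IsIdempotentElem (a ^ n) := by
  obtain ⟨i, j, hij, h⟩ : ∃ i j : ℕ, i < j ∧ a ^ i = a ^ j := by
    obtain ⟨i, j, hne, h⟩ := Finite.exists_ne_map_eq_of_infinite (fun n : ℕ => a ^ n)
    rcases hne.lt_or_gt with hlt | hlt
    · exact ⟨i, j, hlt, h⟩
    · exact ⟨j, i, hlt, h.symm⟩
  obtain ⟨d, rfl⟩ := Nat.exists_eq_add_of_lt hij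
  have key : ∀ k m : ℕ, i ≤ m → a ^ (m + k * (d + 1)) = a ^ m := by
    intro k
    induction k with
    | zero => simp
    | succ k ih =>
      intro m hm
      obtain ⟨c, rfl⟩ := Nat.exists_eq_add_of_le hm
      calc a ^ (i + c + (k + 1) * (d + 1)) = a ^ (i + d + 1) * a ^ (c + k * (d + 1)) := by
            rw [← pow_add]; congr 1; ring
        _ = a ^ (i + c + k * (d + 1)) := by rw [← h, ← pow_add, add_assoc]
        _ = a ^ (i + c) := ih _ hm
  refine ⟨(i + 1) * (d + 1), by positivity, ?_⟩
  rw [IsIdempotentElem, ← pow_add]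
  exact key _ _ (by nlinarith)

/-- An idempotent endomorphism of a purely non-abelian group with central image is trivial. -/
lemma PurelyNonAbelian.apply_eq_one_of_idempotent {G : Type*} [Group G]
    (hG : PurelyNonAbelian G) (e : G →* G) (he : ∀ g, e (e g) = e g)
    (hc : ∀ g, e g ∈ Subgroup.center G) (g : G) : e g = 1 := by
  have hcomm : ∀ a ∈ e.range, ∀ b, a * b = b * a := by
    rintro _ ⟨a, rfl⟩ b
    exact (Subgroup.mem_center_iff.mp (hc a) b).symm
  by_contra hg
  refine hG ⟨e.range, e.ker, fun hbot => hg ?_, fun a b => Subtype.ext (hcomm a a.2 b),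
    fun a ha b _ => hcomm a ha b, ?_, ?_⟩
  · exact Subgroup.mem_bot.mp (hbot ▸ ⟨g, rfl⟩)
  · rw [eq_bot_iff]
    rintro _ ⟨⟨a, rfl⟩, hk⟩
    exact (he a).symm.trans hk
  · rw [eq_top_iff]
    intro x _
    have hx : (e x)⁻¹ * x ∈ e.ker := by simp [MonoidHom.mem_ker, he]
    simpa using Subgroup.mul_mem_sup (MonoidHom.mem_range.mpr ⟨x, rfl⟩ : e x ∈ e.range) hx

/-- An endomorphism of a finite purely non-abelian group with central image is nilpotent. -/
lemma PurelyNonAbelian.exists_iterate_eq_one {G : Type*} [Group G] [Finite G]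
    (hG : PurelyNonAbelian G) (f : Monoid.End G) (hc : ∀ g, f g ∈ Subgroup.center G) :
    ∃ n : ℕ, ∀ g, f^[n + 1] g = 1 := by
  have : Finite (Monoid.End G) := .of_injective _ (DFunLike.coe_injective (F := G →* G))
  obtain ⟨n, hn, he⟩ := exists_pos_isIdempotentElem_pow f
  obtain ⟨n, rfl⟩ := Nat.exists_eq_succ_of_ne_zero hn.ne'
  refine ⟨n, fun g => ?_⟩
  rw [← Monoid.End.coe_pow]
  refine hG.apply_eq_one_of_idempotent (f ^ (n + 1)) (fun x => DFunLike.congr_fun he x)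
    (fun x => ?_) g
  rw [pow_succ']
  exact hc _

/-- The endomorphism `g ↦ g⁻¹ * α g` attached to a central automorphism `α`. -/
def centralAutDisplacement {G : Type*} [Group G] (α : MulAut G) (hα : α ∈ centralAuts G) :
    Monoid.End G :=
  MonoidHom.mk' (fun g => g⁻¹ * α g) fun g h => by
    have := Subgroup.mem_center_iff.mp (hα g) h⁻¹
    rw [map_mul, mul_inv_rev, mul_assoc, ← mul_assoc g⁻¹, ← mul_assoc h⁻¹, this, mul_assoc]

lemma centralAutDisplacement_apply {G : Type*} [Group G] (α : MulAut G)
    (hα : α ∈ centralAuts G) (g : G) : centralAutDisplacement α hα g = g⁻¹ * α g := rfl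

/-- If `α` fixes `h⁻¹ * α h` and has order prime to `p` on a `p`-group, then `α` fixes `h`. -/
lemma IsPGroup.fixed_of_fixed_displacement {p : ℕ} {G : Type*} [Group G] (hG : IsPGroup p G)
    {m : ℕ} (hm : p.Coprime m) {α : MulAut G} (hα : α ^ m = 1) {h : G}
    (hfix : α (h⁻¹ * α h) = h⁻¹ * α h) : α h = h := by
  have key : ∀ k : ℕ, (α ^ k) h = h * (h⁻¹ * α h) ^ k := by
    intro k
    induction k with
    | zero => simp
    | succ k ih =>
      rw [pow_succ', MulAut.mul_apply, ih, map_mul, map_pow, hfix, pow_succ', ← mul_assoc, mul_inv_cancel_left]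
  have h1 : (h⁻¹ * α h) ^ m = 1 := by
    have := key m
    rw [hα, MulAut.one_apply] at this
    exact left_eq_mul.mp this
  have h2 : h⁻¹ * α h = 1 := (hG.powEquiv hm).injective (by simpa using h1)
  exact (inv_mul_eq_one.mp h2).symm

/-- A central automorphism of order prime to `p` of a finite purely non-abelian `p`-group is
trivial. -/
lemma PurelyNonAbelian.centralAut_eq_one {p : ℕ} {G : Type*} [Group G] [Finite G]
    (hG : PurelyNonAbelian G) (hpG : IsPGroup p G) {m : ℕ} (hm : p.Coprime m)
    {α : MulAut G} (hα : α ∈ centralAuts G) (hαm : α ^ m = 1) : α = 1 := by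
  set f := centralAutDisplacement α hα
  have hf : ∀ g, f g = 1 ↔ α g = g := fun g => by
    rw [centralAutDisplacement_apply, inv_mul_eq_one, eq_comm]
  have hiter : ∀ (n : ℕ) (g : G), f^[n + 1] g = 1 → f g = 1 := by
    intro n
    induction n with
    | zero => exact fun g hg => hg
    | succ n ih =>
      intro g hg
      have hfix : α (f g) = f g := (hf _).mp (ih (f g) hg)
      exact (hf g).mpr (hpG.fixed_of_fixed_displacement hm hαm hfix)
  obtain ⟨n, hn⟩ := hG.exists_iterate_eq_one f hα
  exact MulEquiv.ext fun g => (hf g).mp (hiter n g (hn g))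

/-- If `G` is a purely non-abelian finite `p`-group, then `Autcent(G)`
is a `p`-group. -/
theorem centralAuts_isPGroup_of_purelyNonAbelian
    {p : ℕ} (hp : p.Prime) {G : Type*} [Group G] [Finite G]
    (hpG : IsPGroup p G) (hpna : PurelyNonAbelian G) :
    IsPGroup p (centralAuts G) := by
  rintro ⟨α, hα⟩
  obtain ⟨k, m, hm, hk⟩ := Nat.exists_eq_pow_mul_and_not_dvd (orderOf_pos α).ne' p hp.ne_one
  refine ⟨k, Subtype.ext ?_⟩
  refine hpna.centralAut_eq_one hpG (hp.coprime_iff_not_dvd.mpr hm) (pow_mem hα _) ?_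
  change (α ^ p ^ k) ^ m = 1
  rw [← pow_mul, ← hk, pow_orderOf_eq_one]
end

section
/- Let p be a prime and let G be an extraspecial p-group, i.e., a finite p-group with Z(G) = γ₂(G) = Φ(G) of order p (where Φ(G) is the Frattini subgroup). Then every class preserving automorphism of G is inner, i.e., Aut_c(G) = Inn(G). -/
/-- The subgroup of `MulAut G` consisting of class preserving automorphisms. -/
def classPreservingAuts (G : Type*) [Group G] : Subgroup (MulAut G) where
  carrier := {α | ∀ x : G, IsConj x (α x)}
  one_mem' := fun x => by simpa using IsConj.refl x
  mul_mem' := fun {a b} ha hb x => (hb x).trans (ha (b x))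
  inv_mem' := fun {a} ha x => by
    have h := (ha (a⁻¹ x)).symm
    simpa using h

/-- The subgroup of inner automorphisms of `G`. -/
def innerAuts (G : Type*) [Group G] : Subgroup (MulAut G) :=
  (MulAut.conj : G →* MulAut G).range

theorem IsConj.inv_mul_mem_commutator {G : Type*} [Group G] {x y : G} (h : IsConj x y) :
    x⁻¹ * y ∈ commutator G := by
  obtain ⟨c, rfl⟩ := isConj_iff.1 h
  have := Subgroup.commutator_mem_commutator (Subgroup.mem_top x⁻¹) (Subgroup.mem_top c)
  rw [commutatorElement_def, inv_inv] at this
  simpa only [commutator_def, mul_assoc] using this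

/-- The central homomorphism `x ↦ x⁻¹ * α x` attached to an automorphism `α` which induces the
identity modulo the center. -/
def centralHom {G : Type*} [Group G] (α : MulAut G)
    (hα : ∀ x, x⁻¹ * α x ∈ Subgroup.center G) : G →* Subgroup.center G where
  toFun x := ⟨x⁻¹ * α x, hα x⟩
  map_one' := by simp
  map_mul' x y := by
    ext
    have h := Subgroup.mem_center_iff.1 (hα x) y⁻¹
    simp only [map_mul, Subgroup.coe_mul, mul_inv_rev]
    calc y⁻¹ * x⁻¹ * (α x * α y) = y⁻¹ * (x⁻¹ * α x) * α y := by group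
      _ = x⁻¹ * α x * (y⁻¹ * α y) := by rw [h]; group

theorem card_innerAuts (G : Type*) [Group G] :
    Nat.card (innerAuts G) = Nat.card (G ⧸ Subgroup.center G) := by
  have hker : (MulAut.conj : G →* MulAut G).ker = Subgroup.center G := by
    ext g
    simp only [MonoidHom.mem_ker, MulEquiv.ext_iff, MulAut.conj_apply, MulAut.one_apply,
      mul_inv_eq_iff_eq_mul, Subgroup.mem_center_iff]
    exact forall_congr' fun x => eq_comm
  rw [← hker]
  exact (Nat.card_congr (QuotientGroup.quotientKerEquivRange MulAut.conj).toEquiv).symm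

theorem innerAuts_le_classPreservingAuts (G : Type*) [Group G] :
    innerAuts G ≤ classPreservingAuts G := by
  rintro _ ⟨g, rfl⟩ x
  exact isConj_iff.2 ⟨g, rfl⟩

theorem exists_injective_monoidHom_units_complex (A : Type*) [Group A] [Finite A] [IsCyclic A] :
    ∃ ι : A →* ℂˣ, Function.Injective ι := by
  have : NeZero (Nat.card A) := ⟨Nat.card_pos.ne'⟩
  have hcard : Nat.card A = Nat.card (rootsOfUnity (Nat.card A) ℂ) :=
    (HasEnoughRootsOfUnity.natCard_rootsOfUnity ℂ (Nat.card A)).symm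
  exact ⟨(Subgroup.subtype _).comp (mulEquivOfCyclicCardEq hcard).toMonoidHom,
    (Subgroup.subtype_injective _).comp (mulEquivOfCyclicCardEq hcard).injective⟩

theorem card_classPreservingAuts_le (G : Type*) [Group G] [Finite G]
    [IsCyclic (Subgroup.center G)] (h : commutator G ≤ Subgroup.center G) :
    Nat.card (classPreservingAuts G) ≤ Nat.card (Abelianization G) := by
  obtain ⟨ι, hι⟩ := exists_injective_monoidHom_units_complex (Subgroup.center G)
  have e := (CommGroup.monoidHom_mulEquiv_of_hasEnoughRootsOfUnity (Abelianization G) ℂ).some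
  have : Finite (Abelianization G →* ℂˣ) := Finite.of_equiv _ e.symm.toEquiv
  rw [← Nat.card_congr e.toEquiv]
  refine Nat.card_le_card_of_injective (fun α : classPreservingAuts G => Abelianization.lift
    (ι.comp (centralHom α.1 fun x => h (α.2 x).inv_mul_mem_commutator))) fun α β hαβ => ?_
  ext x
  have hx := DFunLike.congr_fun (Abelianization.lift.injective hαβ) x
  exact mul_left_cancel (congrArg Subtype.val (hι hx))

/-- Every class preserving automorphism of an extraspecial `p`-group is inner. -/
theorem extraspecial_class_preserving_is_inner
    {p : ℕ} (hp : p.Prime) {G : Type*} [Group G] [Finite G]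
    (hpG : IsPGroup p G)
    (hZ : Subgroup.center G = commutator G)
    (hF : Subgroup.center G = frattini G)
    (hcard : Nat.card (Subgroup.center G) = p) :
    classPreservingAuts G = innerAuts G := by
  have : Fact p.Prime := ⟨hp⟩
  have : IsCyclic (Subgroup.center G) := isCyclic_of_prime_card hcard
  have : Finite (MulAut G) := DFunLike.finite _
  refine (Subgroup.eq_of_le_of_card_ge (innerAuts_le_classPreservingAuts G) ?_).symm
  have hle := card_classPreservingAuts_le G hZ.ge
  rw [card_innerAuts, hZ]
  exact hle
end

section
/- Let p be an odd prime and let W be the group of all 3 × 3 lower unitriangular matrices over the field 𝔽_{p²} with p² elements (matrices with 1's on the diagonal and 0's above the diagonal). Then W has a class preserving automorphism that is not inner, i.e., Aut_c(W) ≠ Inn(W); moreover, Aut_c(W) is an elementary abelian p-group of order p⁸. -/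
/-- Burnside's group `W`: the group of all `3 × 3` lower unitriangular matrices
over the field `𝔽_{p²}` with `p²` elements. -/
def BurnsideW (p : ℕ) [Fact p.Prime] :
    Subgroup (Matrix (Fin 3) (Fin 3) (GaloisField p 2))ˣ where
  carrier := {M | ∃ x y z : GaloisField p 2,
    (M : Matrix (Fin 3) (Fin 3) (GaloisField p 2)) = !![1, 0, 0; x, 1, 0; z, y, 1]}
  one_mem' := ⟨0, 0, 0, by simp [Matrix.one_fin_three]⟩
  mul_mem' := by
    rintro M N ⟨x, y, z, hM⟩ ⟨x', y', z', hN⟩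
    exact ⟨x + x', y + y', z + y * x' + z', by
      simp [Units.val_mul, hM, hN, Matrix.mul_fin_three, add_assoc]⟩
  inv_mem' := by
    rintro M ⟨x, y, z, hM⟩
    refine ⟨-x, -y, y * x - z, ?_⟩
    have h : (M : Matrix (Fin 3) (Fin 3) (GaloisField p 2)) *
        !![1, 0, 0; -x, 1, 0; y * x - z, -y, 1] = 1 := by
      simp [hM, Matrix.mul_fin_three, Matrix.one_fin_three]; ring_nf
    exact Units.inv_eq_of_mul_eq_one_right h

namespace BurnsideW

variable {p : ℕ} [Fact p.Prime]

/-- The lower unitriangular matrix with subdiagonal entries `x`, `y` and corner entry `z`. -/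
noncomputable def mk (x y z : GaloisField p 2) : BurnsideW p :=
  ⟨⟨!![1, 0, 0; x, 1, 0; z, y, 1], !![1, 0, 0; -x, 1, 0; y * x - z, -y, 1],
    by simp [Matrix.one_fin_three]; ring_nf,
    by simp [Matrix.one_fin_three]⟩, x, y, z, rfl⟩

/-- The two subdiagonal entries of an element of `BurnsideW p`. -/
def subdiag (g : BurnsideW p) : GaloisField p 2 × GaloisField p 2 :=
  ((g : (Matrix (Fin 3) (Fin 3) (GaloisField p 2))ˣ).val 1 0,
    (g : (Matrix (Fin 3) (Fin 3) (GaloisField p 2))ˣ).val 2 1)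

/-- The lower left corner entry of an element of `BurnsideW p`. -/
def corner (g : BurnsideW p) : GaloisField p 2 :=
  (g : (Matrix (Fin 3) (Fin 3) (GaloisField p 2))ˣ).val 2 0

@[simp]
lemma subdiag_mk (x y z : GaloisField p 2) : subdiag (mk x y z) = (x, y) := rfl

@[simp]
lemma corner_mk (x y z : GaloisField p 2) : corner (mk x y z) = z := rfl

lemma exists_eq_mk (g : BurnsideW p) : ∃ x y z, g = mk x y z := by
  obtain ⟨x, y, z, h⟩ := g.2
  exact ⟨x, y, z, Subtype.ext (Units.ext h)⟩

lemma mk_inj {x y z x' y' z' : GaloisField p 2} :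
    mk x y z = mk x' y' z' ↔ x = x' ∧ y = y' ∧ z = z' := by
  refine ⟨fun h => ?_, by rintro ⟨rfl, rfl, rfl⟩; rfl⟩
  have h₁ := congrArg subdiag h
  have h₂ := congrArg corner h
  simp only [subdiag_mk, corner_mk, Prod.mk.injEq] at h₁ h₂
  exact ⟨h₁.1, h₁.2, h₂⟩

lemma mk_mul_mk (x y z x' y' z' : GaloisField p 2) :
    mk x y z * mk x' y' z' = mk (x + x') (y + y') (z + z' + y * x') := by
  refine Subtype.ext (Units.ext ?_)
  simp [mk]
  ring

variable (p) in
/-- Coordinates on `BurnsideW p`. -/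
noncomputable def equivProd : BurnsideW p ≃ (GaloisField p 2 × GaloisField p 2) × GaloisField p 2 where
  toFun g := (subdiag g, corner g)
  invFun v := mk v.1.1 v.1.2 v.2
  left_inv g := by
    obtain ⟨x, y, z, rfl⟩ := exists_eq_mk g
    rfl
  right_inv _ := rfl

lemma isConj_mk_iff {x y z x' y' z' : GaloisField p 2} :
    IsConj (mk x y z) (mk x' y' z') ↔ x = x' ∧ y = y' ∧ (x = 0 → y = 0 → z = z') := by
  rw [isConj_iff]
  constructor
  · rintro ⟨c, hc⟩
    obtain ⟨a, b, d, rfl⟩ := exists_eq_mk c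
    rw [mul_inv_eq_iff_eq_mul, mk_mul_mk, mk_mul_mk, mk_inj] at hc
    obtain ⟨h₁, h₂, h₃⟩ := hc
    obtain rfl : x = x' := by linear_combination h₁
    obtain rfl : y = y' := by linear_combination h₂
    refine ⟨rfl, rfl, ?_⟩
    rintro rfl rfl
    linear_combination h₃
  · rintro ⟨rfl, rfl, h⟩
    by_cases hx : x = 0
    · by_cases hy : y = 0
      · exact ⟨1, by simp [h hx hy]⟩
      · refine ⟨mk ((z - z') / y) 0 0, ?_⟩
        rw [mul_inv_eq_iff_eq_mul, mk_mul_mk, mk_mul_mk, mk_inj]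
        refine ⟨by ring, by ring, by field_simp; ring⟩
    · refine ⟨mk 0 ((z' - z) / x) 0, ?_⟩
      rw [mul_inv_eq_iff_eq_mul, mk_mul_mk, mk_mul_mk, mk_inj]
      refine ⟨by ring, by ring, by field_simp; ring⟩

/-- The automorphism of `BurnsideW p` adding `f` of the subdiagonal to the corner entry. -/
noncomputable def shearAut (f : GaloisField p 2 × GaloisField p 2 →+ GaloisField p 2) :
    MulAut (BurnsideW p) where
  toFun g := mk (subdiag g).1 (subdiag g).2 (corner g + f (subdiag g))
  invFun g := mk (subdiag g).1 (subdiag g).2 (corner g - f (subdiag g))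
  left_inv g := by
    obtain ⟨x, y, z, rfl⟩ := exists_eq_mk g
    simp
  right_inv g := by
    obtain ⟨x, y, z, rfl⟩ := exists_eq_mk g
    simp
  map_mul' g h := by
    obtain ⟨x, y, z, rfl⟩ := exists_eq_mk g
    obtain ⟨x', y', z', rfl⟩ := exists_eq_mk h
    simp only [mk_mul_mk, subdiag_mk, corner_mk, mk_inj, true_and]
    rw [← Prod.mk_add_mk, map_add]
    ring

@[simp]
lemma shearAut_mk (f : GaloisField p 2 × GaloisField p 2 →+ GaloisField p 2)
    (x y z : GaloisField p 2) : shearAut f (mk x y z) = mk x y (z + f (x, y)) := rfl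

lemma shearAut_mem (f : GaloisField p 2 × GaloisField p 2 →+ GaloisField p 2) :
    shearAut f ∈ classPreservingAuts (BurnsideW p) := by
  intro g
  obtain ⟨x, y, z, rfl⟩ := exists_eq_mk g
  rw [shearAut_mk, isConj_mk_iff]
  refine ⟨rfl, rfl, ?_⟩
  rintro rfl rfl
  simp [← Prod.zero_eq_mk]

variable (p) in
/-- Additive maps as class preserving automorphisms of `BurnsideW p`. -/
noncomputable def shearHom : Multiplicative (GaloisField p 2 × GaloisField p 2 →+ GaloisField p 2) →*
    classPreservingAuts (BurnsideW p) :=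
  MonoidHom.mk' (fun f => ⟨shearAut f.toAdd, shearAut_mem _⟩) fun f₁ f₂ => by
    refine Subtype.ext (MulEquiv.ext fun g => ?_)
    obtain ⟨x, y, z, rfl⟩ := exists_eq_mk g
    simp only [Subgroup.coe_mul, MulAut.mul_apply, shearAut_mk, toAdd_mul, AddMonoidHom.add_apply,
      mk_inj, true_and]
    ring

lemma shearHom_injective : Function.Injective (shearHom p) := by
  intro f₁ f₂ h
  refine Multiplicative.toAdd.injective (AddMonoidHom.ext fun v => ?_)
  have h' : shearAut f₁.toAdd (mk v.1 v.2 0) = shearAut f₂.toAdd (mk v.1 v.2 0) :=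
    congrArg (fun a : classPreservingAuts (BurnsideW p) => a.1 (mk v.1 v.2 0)) h
  simpa [mk_inj] using h'

lemma shearHom_surjective : Function.Surjective (shearHom p) := by
  rintro ⟨α, hα⟩
  have hcentral (z : GaloisField p 2) : α (mk 0 0 z) = mk 0 0 z := by
    obtain ⟨x', y', z', h⟩ := exists_eq_mk (α (mk 0 0 z))
    have hc := hα (mk 0 0 z)
    rw [h, isConj_mk_iff] at hc
    rw [h, mk_inj]
    exact ⟨hc.1.symm, hc.2.1.symm, (hc.2.2 rfl rfl).symm⟩
  have hα₀ (x y : GaloisField p 2) : α (mk x y 0) = mk x y (corner (α (mk x y 0))) := by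
    obtain ⟨x', y', z', h⟩ := exists_eq_mk (α (mk x y 0))
    have hc := hα (mk x y 0)
    rw [h, isConj_mk_iff] at hc
    rw [h, mk_inj]
    exact ⟨hc.1.symm, hc.2.1.symm, rfl⟩
  have hα' (x y z : GaloisField p 2) :
      α (mk x y z) = mk x y (z + corner (α (mk x y 0))) := by
    have hz : mk x y z = mk 0 0 z * mk x y 0 := by simp [mk_mul_mk]
    rw [hz, map_mul, hcentral, hα₀, mk_mul_mk]
    simp
  refine ⟨Multiplicative.ofAdd (AddMonoidHom.mk' (fun v => corner (α (mk v.1 v.2 0))) ?_), ?_⟩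
  · rintro ⟨x, y⟩ ⟨x', y'⟩
    have h := map_mul α (mk x y 0) (mk x' y' 0)
    rw [mk_mul_mk, hα', hα₀ x y, hα₀ x' y', mk_mul_mk, mk_inj] at h
    simp only [Prod.mk_add_mk]
    linear_combination h.2.2
  · refine Subtype.ext (MulEquiv.ext fun g => ?_)
    obtain ⟨x, y, z, rfl⟩ := exists_eq_mk g
    exact (hα' x y z).symm

lemma shearHom_bijective : Function.Bijective (shearHom p) :=
  ⟨shearHom_injective, shearHom_surjective⟩

lemma card_eq : Nat.card (BurnsideW p) = p ^ 6 := by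
  rw [Nat.card_congr (equivProd p), Nat.card_prod, Nat.card_prod, GaloisField.card p 2 two_ne_zero]
  ring

lemma card_addMonoidHom :
    Nat.card (GaloisField p 2 × GaloisField p 2 →+ GaloisField p 2) = p ^ 8 := by
  have e : (GaloisField p 2 × GaloisField p 2 →+ GaloisField p 2) ≃
      (GaloisField p 2 × GaloisField p 2 →ₗ[ZMod p] GaloisField p 2) :=
    { toFun := fun f => f.toZModLinearMap p
      invFun := fun f => f.toAddMonoidHom
      left_inv := fun _ => rfl
      right_inv := fun _ => rfl }
  rw [Nat.card_congr e, Module.natCard_eq_pow_finrank (K := ZMod p), Nat.card_zmod,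
    Module.finrank_linearMap, Module.finrank_prod, GaloisField.finrank p two_ne_zero]

lemma card_classPreservingAuts : Nat.card (classPreservingAuts (BurnsideW p)) = p ^ 8 := by
  rw [← Nat.card_congr (Equiv.ofBijective _ (shearHom_bijective (p := p)))]
  exact card_addMonoidHom

lemma card_innerAuts_le : Nat.card (innerAuts (BurnsideW p)) ≤ p ^ 6 := by
  have : Finite (BurnsideW p) := Nat.finite_of_card_ne_zero <| by
    rw [card_eq]
    exact pow_ne_zero _ (Fact.out : p.Prime).ne_zero
  rw [← card_eq]
  exact Nat.card_le_card_of_surjective _ (MulAut.conj : BurnsideW p →* _).rangeRestrict_surjective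

end BurnsideW

/-- For an odd prime `p`, Burnside's group `W` of lower unitriangular `3 × 3`
matrices over `𝔽_{p²}` has a non-inner class preserving automorphism, and
`Aut_c(W)` is an elementary abelian `p`-group of order `p^8`. -/
theorem burnsideW_outc_ne_one_and_autc_elem_abelian
    (p : ℕ) [hp : Fact p.Prime] (hodd : p ≠ 2) :
    classPreservingAuts (BurnsideW p) ≠ innerAuts (BurnsideW p) ∧
    (∀ a b : classPreservingAuts (BurnsideW p), a * b = b * a) ∧
    (∀ a : classPreservingAuts (BurnsideW p), a ≠ 1 → orderOf a = p) ∧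
    Nat.card (classPreservingAuts (BurnsideW p)) = p ^ 8 := by
  open BurnsideW in
  refine ⟨fun h => ?_, fun a b => ?_, fun a ha => ?_, card_classPreservingAuts⟩
  · have hle := card_innerAuts_le (p := p)
    rw [← h, card_classPreservingAuts] at hle
    exact absurd hle (Nat.pow_lt_pow_right hp.out.one_lt (by norm_num)).not_ge
  · obtain ⟨f, rfl⟩ := shearHom_surjective a
    obtain ⟨g, rfl⟩ := shearHom_surjective b
    rw [← map_mul, ← map_mul, mul_comm]
  · obtain ⟨f, rfl⟩ := shearHom_surjective a
    refine orderOf_eq_prime ?_ ha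
    rw [← map_pow, show f ^ p = 1 from ?_, map_one]
    refine Multiplicative.toAdd.injective (AddMonoidHom.ext fun v => ?_)
    simp
end

section
/- Let p be a prime and let G be a group of order p⁴. Then every class preserving automorphism of G is inner, i.e., Aut_c(G) = Inn(G). -/
/-- A proper subgroup of a finite `p`-group has at most `|K| / p` elements. -/
theorem IsPGroup.mul_card_le_of_ne_top {p : ℕ} [Fact p.Prime] {K : Type*} [Group K] [Finite K]
    (hK : IsPGroup p K) {H : Subgroup K} (hH : H ≠ ⊤) : p * Nat.card H ≤ Nat.card K := by
  obtain ⟨j, hj⟩ := hK.index H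
  have hj0 : j ≠ 0 := by
    rintro rfl
    exact hH (Subgroup.index_eq_one.mp (by simpa using hj))
  rw [← H.index_mul_card, hj]
  exact Nat.mul_le_mul_right _ (Nat.le_self_pow hj0 p)

/-- If `p` subgroups cover a finite `p`-group, then one of them is the whole group. -/
theorem IsPGroup.exists_eq_top_of_cover {p : ℕ} [Fact p.Prime] {K : Type*} [Group K] [Finite K]
    (hK : IsPGroup p K) (H : Fin p → Subgroup K) (hcover : ∀ k, ∃ i, k ∈ H i) :
    ∃ i, H i = ⊤ := by
  by_contra! hne
  have hp : 1 < p := (Fact.out : p.Prime).one_lt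
  have hsub : ({1}ᶜ : Set K) ⊆ ⋃ i, ((H i : Set K) \ {1}) := by
    intro k hk
    obtain ⟨i, hi⟩ := hcover k
    exact Set.mem_iUnion.mpr ⟨i, hi, hk⟩
  have hdiff (i : Fin p) : ((H i : Set K) \ {1}).ncard + 1 = Nat.card (H i) :=
    Set.ncard_sdiff_singleton_add_one (H i).one_mem
  have hcompl : 1 + ({1}ᶜ : Set K).ncard = Nat.card K := by
    simpa using Set.ncard_add_ncard_compl ({1} : Set K)
  have hle : ({1}ᶜ : Set K).ncard ≤ ∑ i, ((H i : Set K) \ {1}).ncard :=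
    (Set.ncard_le_ncard hsub).trans (Set.ncard_iUnion_le_of_fintype _)
  have hsum : p * (∑ i, ((H i : Set K) \ {1}).ncard + p) ≤ p * Nat.card K := by
    calc p * (∑ i, ((H i : Set K) \ {1}).ncard + p)
        = ∑ i, p * Nat.card (H i) := by
          simp [← hdiff, Finset.sum_add_distrib, mul_add, Finset.mul_sum]
      _ ≤ ∑ _i : Fin p, Nat.card K :=
          Finset.sum_le_sum fun i _ => hK.mul_card_le_of_ne_top (hne i)
      _ = p * Nat.card K := by simp
  have := Nat.le_of_mul_le_mul_left hsum (by omega)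
  omega

/-- In a finite `p`-group with an abelian normal subgroup of index `p`, every class preserving
automorphism is inner. -/
theorem mem_innerAuts_of_commute_of_index_eq {p : ℕ} [Fact p.Prime] {G : Type*} [Group G]
    [Finite G] (hG : IsPGroup p G) (A : Subgroup G) [A.Normal]
    (hcomm : ∀ a ∈ A, ∀ b ∈ A, a * b = b * a) (hindex : A.index = p)
    {α : MulAut G} (hα : α ∈ classPreservingAuts G) : α ∈ innerAuts G := by
  have hcard : Nat.card (G ⧸ A) = p := hindex
  obtain ⟨x, hx⟩ : ∃ x, x ∉ A := by
    by_contra! h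
    have : A = ⊤ := by ext; simp [h]
    rw [this, Subgroup.index_top] at hindex
    exact (Fact.out : p.Prime).one_lt.ne hindex
  have hx1 : (x : G ⧸ A) ≠ 1 := by rwa [Ne, QuotientGroup.eq_one_iff]
  have hdecomp (g : G) : ∃ i < p, ∃ a ∈ A, g = x ^ i * a := by
    obtain ⟨n, hn⟩ := mem_powers_of_prime_card hcard hx1 (g' := (g : G ⧸ A))
    refine ⟨n % p, Nat.mod_lt _ (Fact.out : p.Prime).pos, (x ^ (n % p))⁻¹ * g, ?_, by group⟩
    rw [← QuotientGroup.eq, ← hn, QuotientGroup.mk_pow]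
    nth_rewrite 1 [← hcard]
    exact pow_mod_natCard _ _
  obtain ⟨c, hc⟩ := isConj_iff.mp (hα x)
  have hβ : (MulAut.conj c)⁻¹ * α ∈ classPreservingAuts G :=
    mul_mem (inv_mem fun y => isConj_iff.mpr ⟨c, rfl⟩) hα
  have hβx : ((MulAut.conj c)⁻¹ * α) x = x := by simp [← hc, mul_assoc]
  suffices h : (MulAut.conj c)⁻¹ * α ∈ innerAuts G by
    have := mul_mem (show MulAut.conj c ∈ innerAuts G from ⟨c, rfl⟩) h
    simpa using this
  generalize (MulAut.conj c)⁻¹ * α = β at hβ hβx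
  obtain ⟨i, hi⟩ := (hG.to_subgroup A).exists_eq_top_of_cover
    (fun i => (β.toMonoidHom.comp A.subtype).eqLocus
      ((MulAut.conj (x ^ (i : ℕ))).toMonoidHom.comp A.subtype)) <| by
    rintro ⟨a, ha⟩
    obtain ⟨g, hg⟩ := isConj_iff.mp (hβ a)
    obtain ⟨i, hi, b, hb, rfl⟩ := hdecomp g
    refine ⟨⟨i, hi⟩, ?_⟩
    change β a = x ^ i * a * (x ^ i)⁻¹
    rw [← hg, mul_inv_rev, mul_assoc (x ^ i), hcomm b hb a ha]
    group
  refine ⟨x ^ (i : ℕ), ?_⟩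
  ext g
  obtain ⟨n, -, a, ha, rfl⟩ := hdecomp g
  have hβa : β a = x ^ (i : ℕ) * a * (x ^ (i : ℕ))⁻¹ :=
    (hi ▸ Subgroup.mem_top (⟨a, ha⟩ : A) :)
  rw [map_mul β, map_pow β, hβx, hβa, MulAut.conj_apply]
  simp only [← mul_assoc, ← pow_add, add_comm]

/-- The homomorphism `g ↦ ⁅g, n⁆` into the center, for `n` central modulo the center. -/
def commutatorHom {G : Type*} [Group G] (n : G)
    (hn : ∀ g, g * n * g⁻¹ * n⁻¹ ∈ Subgroup.center G) : G →* Subgroup.center G where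
  toFun g := ⟨g * n * g⁻¹ * n⁻¹, hn g⟩
  map_one' := by simp
  map_mul' a b := by
    ext
    have h := Subgroup.mem_center_iff.mp (hn b) a
    simp only [Subgroup.coe_mul]
    calc a * b * n * (a * b)⁻¹ * n⁻¹
        = (a * (b * n * b⁻¹ * n⁻¹)) * (n * a⁻¹ * n⁻¹) := by group
      _ = (b * n * b⁻¹ * n⁻¹) * (a * n * a⁻¹ * n⁻¹) := by rw [h]; group
      _ = _ := (Subgroup.mem_center_iff.mp (hn b) _).symm

theorem mem_ker_commutatorHom {G : Type*} [Group G] {n : G}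
    {hn : ∀ g, g * n * g⁻¹ * n⁻¹ ∈ Subgroup.center G} {g : G} :
    g ∈ (commutatorHom n hn).ker ↔ g * n = n * g := by
  rw [MonoidHom.mem_ker, Subtype.ext_iff]
  change g * n * g⁻¹ * n⁻¹ = 1 ↔ _
  rw [mul_inv_eq_one, mul_inv_eq_iff_eq_mul]

/-- A nonabelian finite `p`-group has a noncentral element that is central modulo the center. -/
theorem IsPGroup.exists_notMem_center_commutator_mem {p : ℕ} [Fact p.Prime] {G : Type*} [Group G]
    [Finite G] (hG : IsPGroup p G) (hZ : Subgroup.center G ≠ ⊤) :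
    ∃ n ∉ Subgroup.center G, ∀ g, g * n * g⁻¹ * n⁻¹ ∈ Subgroup.center G := by
  have : Nontrivial (G ⧸ Subgroup.center G) := QuotientGroup.nontrivial_iff.mpr hZ
  have := (hG.to_quotient (Subgroup.center G)).center_nontrivial
  obtain ⟨⟨q, hq⟩, hq1⟩ := exists_ne (1 : Subgroup.center (G ⧸ Subgroup.center G))
  obtain ⟨n, rfl⟩ := QuotientGroup.mk_surjective q
  refine ⟨n, fun h => hq1 (Subtype.ext ((QuotientGroup.eq_one_iff n).mpr h)), fun g => ?_⟩
  rw [← QuotientGroup.eq_one_iff]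
  change (g * n * (g : G ⧸ Subgroup.center G)⁻¹ * (n : G ⧸ Subgroup.center G)⁻¹) = 1
  rw [Subgroup.mem_center_iff.mp hq]
  group

/-- A nonabelian group of order `p ^ 4` has an abelian normal subgroup of index `p`. -/
theorem exists_normal_commute_index_eq {p : ℕ} [Fact p.Prime] {G : Type*} [Group G]
    (hcard : Nat.card G = p ^ 4) (hZ : Subgroup.center G ≠ ⊤) :
    ∃ A : Subgroup G, A.Normal ∧ (∀ a ∈ A, ∀ b ∈ A, a * b = b * a) ∧ A.index = p := by
  have hp : p.Prime := Fact.out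
  have : Finite G := Nat.finite_of_card_ne_zero (by simp [hcard, hp.ne_zero])
  have hG : IsPGroup p G := .of_card hcard
  obtain ⟨n, hnZ, hn⟩ := hG.exists_notMem_center_commutator_mem hZ
  set C := (commutatorHom n hn).ker with hC
  have hZC : Subgroup.center G ≤ C := fun z hz =>
    mem_ker_commutatorHom.mpr (Subgroup.mem_center_iff.mp hz n).symm
  have hnC : n ∈ C := mem_ker_commutatorHom.mpr rfl
  have hlt : (Subgroup.center G).subgroupOf C < Subgroup.center C := by
    refine lt_of_le_of_ne (fun z hz => Subgroup.mem_center_iff.mpr fun c =>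
      Subtype.ext (Subgroup.mem_center_iff.mp hz c)) fun h => ?_
    have : (⟨n, hnC⟩ : C) ∈ (Subgroup.center G).subgroupOf C := by
      rw [h, Subgroup.mem_center_iff]
      exact fun c => Subtype.ext (mem_ker_commutatorHom.mp c.2)
    exact hnZ this
  obtain ⟨k, hk0, hk⟩ := IsPGroup.card_center_eq_prime_pow hcard (by norm_num)
  obtain ⟨j, hj⟩ := hG.index C
  obtain ⟨m, hm⟩ := IsPGroup.iff_card.mp ((hG.to_subgroup C).to_subgroup (Subgroup.center C))
  obtain ⟨l, hl⟩ := (hG.to_subgroup C).index (Subgroup.center C)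
  have hj0 : j ≠ 0 := by
    rintro rfl
    have htop : C = ⊤ := Subgroup.index_eq_one.mp (by simpa using hj)
    exact hnZ (Subgroup.mem_center_iff.mpr fun g =>
      mem_ker_commutatorHom.mp (hC ▸ htop ▸ Subgroup.mem_top g))
  have hjk : j ≤ k := by
    rw [← Nat.pow_le_pow_iff_right hp.one_lt, ← hj, ← hk, hC, Subgroup.index_ker]
    exact Subgroup.card_le_card_group _
  have hkm : k < m := by
    rw [← Nat.pow_lt_pow_iff_right hp.one_lt, ← hm, ← hk,
      ← Nat.card_congr (Subgroup.subgroupOfEquivOfLe hZC).toEquiv]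
    exact Set.ncard_lt_ncard hlt
  have hsum : j + (l + m) = 4 := by
    apply Nat.pow_right_injective hp.two_le
    simp only [pow_add]
    rw [← hj, ← hl, ← hm, Subgroup.index_mul_card, Subgroup.index_mul_card, hcard]
  obtain rfl : j = 1 := by omega
  have hcyc : IsCyclic (C ⧸ Subgroup.center C) := by
    obtain rfl | rfl : l = 0 ∨ l = 1 := by omega
    · have : Subsingleton (C ⧸ Subgroup.center C) :=
        (Nat.card_eq_one_iff_unique.mp (hl.trans (pow_zero p))).1
      infer_instance
    · exact isCyclic_of_prime_card (hl.trans (pow_one p))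
  have hmul := isMulCommutative_of_isCyclic_quotient_center_self (G := C)
  exact ⟨C, inferInstance, fun a ha b hb =>
    congrArg Subtype.val (hmul.is_comm.comm (⟨a, ha⟩ : C) ⟨b, hb⟩), by simpa using hj⟩

/-- Every class preserving automorphism of a group of order `p⁴` is inner. -/
theorem class_preserving_is_inner_of_card_p_pow_four
    {p : ℕ} (hp : p.Prime) {G : Type*} [Group G]
    (hcard : Nat.card G = p ^ 4) :
    classPreservingAuts G = innerAuts G := by
  have : Fact p.Prime := ⟨hp⟩
  have : Finite G := Nat.finite_of_card_ne_zero (by simp [hcard, hp.ne_zero])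
  refine le_antisymm (fun α hα => ?_) ?_
  · by_cases hZ : Subgroup.center G = ⊤
    · refine ⟨1, ?_⟩
      ext x
      obtain ⟨c, hc⟩ := isConj_iff.mp (hα x)
      have hx : c * x = x * c := Subgroup.mem_center_iff.mp (hZ ▸ Subgroup.mem_top x) c
      rw [← hc, hx]
      simp
    · obtain ⟨A, hA, hcomm, hindex⟩ := exists_normal_commute_index_eq hcard hZ
      exact mem_innerAuts_of_commute_of_index_eq (.of_card hcard) A hcomm hindex hα
  · rintro _ ⟨g, rfl⟩ x
    exact isConj_iff.mpr ⟨g, rfl⟩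
end

section
/- Let p be a prime and let G be a finite p-group having a maximal cyclic subgroup, i.e., a cyclic subgroup of index p in G. Then every class preserving automorphism of G is inner, i.e., Aut_c(G) = Inn(G). -/
/-- If `H` is normal of prime index and `y ∉ H`, then `G = H⟨y⟩`. -/
theorem exists_mul_zpow_of_index_prime {p : ℕ} (hp : p.Prime) {G : Type*} [Group G]
    (H : Subgroup G) [H.Normal] (hidx : H.index = p) {y : G} (hy : y ∉ H) (g : G) :
    ∃ h ∈ H, ∃ j : ℤ, g = h * y ^ j := by
  have : Fact p.Prime := ⟨hp⟩
  have hy' : (y : G ⧸ H) ≠ 1 := fun h => hy ((QuotientGroup.eq_one_iff y).1 h)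
  obtain ⟨j, hj⟩ := Subgroup.mem_zpowers_iff.1
    (mem_zpowers_of_prime_card (g' := (g : G ⧸ H)) hidx hy')
  refine ⟨g * (y ^ j)⁻¹, ?_, j, by simp⟩
  rw [← QuotientGroup.eq_one_iff, QuotientGroup.mk_mul, QuotientGroup.mk_inv,
    QuotientGroup.mk_zpow, hj, mul_inv_cancel]

/-- A subgroup of index `p` in a finite `p`-group is normal. -/
theorem IsPGroup.normal_of_index_eq_prime {p : ℕ} (hp : p.Prime) {G : Type*} [Group G] [Finite G]
    (hpG : IsPGroup p G) (H : Subgroup G) (hidx : H.index = p) : H.Normal := by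
  have : Fact p.Prime := ⟨hp⟩
  obtain ⟨n, hn⟩ := IsPGroup.iff_card.1 hpG
  have hn0 : n ≠ 0 := by
    rintro rfl
    have h := H.index_dvd_card
    rw [hn, hidx, pow_zero] at h
    exact hp.one_lt.ne' (Nat.dvd_one.1 h)
  apply Subgroup.normal_of_index_eq_minFac_card
  rw [hn, hp.pow_minFac hn0, hidx]

/-- A class preserving automorphism which fixes a generator of a normal cyclic subgroup of prime
index is inner. -/
theorem mem_innerAuts_of_fixes_generator {p : ℕ} (hp : p.Prime) {G : Type*} [Group G]
    {x : G} [(Subgroup.zpowers x).Normal] (hidx : (Subgroup.zpowers x).index = p)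
    {α : MulAut G} (hα : α ∈ classPreservingAuts G) (hx : α x = x) : α ∈ innerAuts G := by
  obtain ⟨y, hy⟩ : ∃ y, y ∉ Subgroup.zpowers x := by
    by_contra! h
    rw [(Subgroup.eq_top_iff' _).2 h, Subgroup.index_top] at hidx
    exact hp.one_lt.ne hidx
  obtain ⟨g, hg⟩ := isConj_iff.1 (hα y)
  obtain ⟨_, ⟨k, rfl⟩, j, rfl⟩ := exists_mul_zpow_of_index_prime hp _ hidx hy g
  have hαy : MulAut.conj (x ^ k) y = α y := by
    rw [← hg, MulAut.conj_apply]
    group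
  have hαx : MulAut.conj (x ^ k) x = α x := by
    rw [hx, MulAut.conj_apply]
    group
  refine ⟨x ^ k, MulEquiv.ext fun z => ?_⟩
  obtain ⟨_, ⟨m, rfl⟩, l, rfl⟩ := exists_mul_zpow_of_index_prime hp _ hidx hy z
  simp only [map_mul, map_zpow] at hαx hαy ⊢
  rw [hαx, hαy]

/-- Every class preserving automorphism of a finite `p`-group having a maximal
cyclic subgroup (a cyclic subgroup of index `p`) is inner. -/
theorem class_preserving_is_inner_of_maximal_cyclic
    {p : ℕ} (hp : p.Prime) {G : Type*} [Group G] [Finite G]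
    (hpG : IsPGroup p G)
    (H : Subgroup G) (hcyc : IsCyclic H) (hidx : H.index = p) :
    classPreservingAuts G = innerAuts G := by
  refine le_antisymm (fun α hα => ?_) (innerAuts_le_classPreservingAuts G)
  have hnormal := hpG.normal_of_index_eq_prime hp H hidx
  obtain ⟨x, rfl⟩ := Subgroup.isCyclic_iff_exists_zpowers_eq_top H |>.1 hcyc
  obtain ⟨c, hc⟩ := isConj_iff.1 (hα x)
  have hcinner : MulAut.conj c ∈ innerAuts G := ⟨c, rfl⟩
  have hfix : ((MulAut.conj c)⁻¹ * α) x = x := by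
    rw [MulAut.mul_apply, ← hc, ← MulAut.conj_apply, MulAut.inv_apply_self]
  have h := mem_innerAuts_of_fixes_generator hp hidx
    (mul_mem (inv_mem (innerAuts_le_classPreservingAuts G hcinner)) hα) hfix
  simpa using mul_mem hcinner h
end

section
/- Let p be an odd prime and let G be a group of order pⁿ having a cyclic subgroup of order p^{n-2}. Then every class preserving automorphism of G is inner, i.e., Aut_c(G) = Inn(G). -/
theorem exists_conj_of_closure_eq_top {G : Type*} [Group G] {a b : G}
    (hgen : Subgroup.closure {a, b} = ⊤)
    (hfac : ∀ g : G, ∃ u v : G, g = u * v ∧ Commute u a ∧ Commute v b)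
    {α : MulAut G} (hα : α ∈ classPreservingAuts G) :
    ∃ g : G, MulAut.conj g = α := by
  obtain ⟨g, hg⟩ := isConj_iff.1 (hα a)
  obtain ⟨x, hx⟩ := isConj_iff.1 (hα b)
  obtain ⟨u, v, huv, hu, hv⟩ := hfac (g⁻¹ * x)
  refine ⟨g * u, ?_⟩
  have key : ((MulAut.conj (g * u) : MulAut G) : G →* G) = (α : G →* G) := by
    refine MonoidHom.eq_of_eqOn_dense hgen ?_
    rintro y (rfl | rfl)
    · change g * u * y * (g * u)⁻¹ = α y
      rw [← hg, mul_assoc g u y, hu.eq]; group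
    · have hx' : x = g * u * v := by rw [mul_assoc, ← huv]; group
      change g * u * y * (g * u)⁻¹ = α y
      rw [← hx, hx', mul_assoc _ v y, hv.eq]; group
  exact MulEquiv.ext fun y => DFunLike.congr_fun key y

theorem IsPGroup.exists_eq_top_of_forall_mem {p : ℕ} [hp : Fact p.Prime] {A : Type*} [Group A]
    [Finite A] (hA : IsPGroup p A) (S : ℕ → Subgroup A)
    (hS : ∀ a, ∃ i < p, a ∈ S i) : ∃ i < p, S i = ⊤ := by
  by_contra! hne
  obtain ⟨N, hN⟩ := IsPGroup.iff_card.1 hA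
  have hpos : 0 < Nat.card A := Nat.card_pos
  have hlt : ∀ i < p, Nat.card (S i) * p ≤ Nat.card A := by
    intro i hi
    obtain ⟨k, hk⟩ := hA.index (S i)
    have hk0 : k ≠ 0 := by
      rintro rfl
      exact hne i hi (Subgroup.index_eq_one.1 (by simpa using hk))
    rw [← (S i).card_mul_index, hk]
    exact Nat.mul_le_mul_left _ (Nat.le_self_pow hk0 p)
  have hcover : (Set.univ : Set A) \ {1} = ⋃ i ∈ Finset.range p, ((S i : Set A) \ {1}) := by
    ext a
    simp only [Set.mem_sdiff, Set.mem_univ, true_and, Set.mem_iUnion, Finset.mem_range,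
      SetLike.mem_coe, exists_prop]
    exact ⟨fun h => (hS a).imp fun i hi => ⟨hi.1, hi.2, h⟩, fun ⟨i, _, _, h⟩ => h⟩
  have h1 := Finset.set_ncard_biUnion_le (Finset.range p) fun i => ((S i : Set A) \ {1})
  rw [← hcover, Set.ncard_sdiff_singleton_of_mem (Set.mem_univ _), Set.ncard_univ] at h1
  have h2 : ∀ i ∈ Finset.range p, ((S i : Set A) \ {1}).ncard ≤ Nat.card A / p - 1 := by
    intro i hi
    rw [Set.ncard_sdiff_singleton_of_mem (S i).one_mem]
    refine Nat.sub_le_sub_right ((Nat.le_div_iff_mul_le hp.out.pos).2 ?_) 1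
    exact hlt i (Finset.mem_range.1 hi)
  have h3 := h1.trans (Finset.sum_le_sum h2)
  rw [Finset.sum_const, Finset.card_range, smul_eq_mul, Nat.mul_sub, mul_one] at h3
  have h4 := Nat.mul_div_le (Nat.card A) p
  have h5 := hlt 0 hp.out.pos
  have h6 : 0 < Nat.card (S 0) := Nat.card_pos
  have h7 := Nat.mul_le_mul_right p h6
  have := hp.out.two_le
  omega

theorem exists_conj_of_commute_of_pow_mem {p : ℕ} [hp : Fact p.Prime] {G : Type*} [Group G]
    [Finite G] (hG : IsPGroup p G) (A : Subgroup G) (hA : ∀ a ∈ A, ∀ b ∈ A, Commute a b)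
    {y : G} (hy : y ^ p ∈ A) (hfac : ∀ g : G, ∃ a ∈ A, ∃ k : ℤ, g = a * y ^ k)
    {α : MulAut G} (hα : α ∈ classPreservingAuts G) :
    ∃ g : G, MulAut.conj g = α := by
  obtain ⟨x, hx⟩ := isConj_iff.1 (hα y)
  set S : ℕ → Subgroup A := fun i =>
    MonoidHom.eqLocus (((MulAut.conj (x * y ^ i) : MulAut G) : G →* G).comp A.subtype)
      ((α : G →* G).comp A.subtype)
  have hS : ∀ i (a : A), a ∈ S i ↔ x * y ^ i * a * (x * y ^ i)⁻¹ = α a := fun i a => Iff.rfl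
  have hcov : ∀ a : A, ∃ i < p, a ∈ S i := by
    intro a
    obtain ⟨g, hg⟩ := isConj_iff.1 (hα a)
    obtain ⟨b, hb, k, hk⟩ := hfac (g⁻¹ * x)
    have hp0 : (p : ℤ) ≠ 0 := by exact_mod_cast hp.out.ne_zero
    refine ⟨((-k) % p).toNat, ?_, ?_⟩
    · have := Int.emod_lt_of_pos (-k) (by exact_mod_cast hp.out.pos : (0 : ℤ) < p)
      have := Int.emod_nonneg (-k) hp0
      omega
    · rw [hS, ← zpow_natCast y, Int.toNat_of_nonneg (Int.emod_nonneg (-k) hp0)]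
      have hg' : g = x * y ^ (-k) * b⁻¹ := by
        have : g = x * (b * y ^ k)⁻¹ := by rw [← hk]; group
        rw [this]; group
      have hmod : y ^ (-k) = y ^ ((-k) % (p : ℤ)) * (y ^ p) ^ ((-k) / (p : ℤ)) := by
        rw [← zpow_natCast y p, ← zpow_mul, ← zpow_add, Int.emod_add_mul_ediv]
      set w := (y ^ p) ^ ((-k) / (p : ℤ)) * b⁻¹ with hw
      have hwA : w ∈ A := A.mul_mem (A.zpow_mem hy _) (A.inv_mem hb)
      have hg'' : g = x * y ^ ((-k) % (p : ℤ)) * w := by rw [hg', hmod, hw]; group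
      rw [← hg, hg'', mul_assoc _ w (a : G), (hA w hwA a a.2).eq]
      group
  obtain ⟨i, -, hi⟩ := (hG.to_subgroup A).exists_eq_top_of_forall_mem S hcov
  refine ⟨x * y ^ i, MulEquiv.ext fun g => ?_⟩
  obtain ⟨a, ha, k, rfl⟩ := hfac g
  have h1 : MulAut.conj (x * y ^ i) a = α a := (hS i ⟨a, ha⟩).1 (by rw [hi]; trivial)
  have h2 : MulAut.conj (x * y ^ i) y = α y := by
    rw [← hx, MulAut.conj_apply, mul_assoc x, ← pow_succ, pow_succ']; group
  rw [map_mul (MulAut.conj (x * y ^ i) : MulAut G), map_zpow (MulAut.conj (x * y ^ i) : MulAut G),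
    map_mul α, map_zpow α, h1, h2]

theorem exists_eq_mul_zpow_of_index_prime {p : ℕ} [Fact p.Prime] {G : Type*} [Group G]
    (N : Subgroup G) [N.Normal] (hN : N.index = p) {x : G} (hx : x ∉ N) (g : G) :
    ∃ n ∈ N, ∃ k : ℤ, g = n * x ^ k := by
  have h := mem_zpowers_of_prime_card (G := G ⧸ N) (p := p) hN (g := (x : G ⧸ N)) (g' := (g : G ⧸ N))
    (by rwa [ne_eq, QuotientGroup.eq_one_iff])
  obtain ⟨k, hk⟩ := Subgroup.mem_zpowers_iff.1 h
  refine ⟨g * (x ^ k)⁻¹, ?_, k, by group⟩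
  rw [← QuotientGroup.eq_one_iff, QuotientGroup.mk_mul, QuotientGroup.mk_inv,
    QuotientGroup.mk_zpow, hk, mul_inv_cancel]

theorem IsPGroup.normal_of_index_eq {p : ℕ} [hp : Fact p.Prime] {G : Type*} [Group G] [Finite G]
    (hG : IsPGroup p G) {N : Subgroup G} (hN : N.index = p) : N.Normal := by
  apply Subgroup.normal_of_index_eq_minFac_card
  obtain ⟨n, hn⟩ := IsPGroup.iff_card.1 hG
  have hn0 : n ≠ 0 := by
    rintro rfl
    have := N.index_dvd_card
    rw [hn, hN, pow_zero] at this
    exact hp.out.one_lt.ne' (Nat.dvd_one.1 this)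
  rw [hN, hn, Nat.pow_minFac hn0, hp.out.minFac_eq]

theorem mul_mul_inv_mul_inv_mem_center_of_card_eq_prime_cube {p : ℕ} [hp : Fact p.Prime] {G : Type*}
    [Group G] (hG : Nat.card G = p ^ 3) (a b : G) :
    a * b * a⁻¹ * b⁻¹ ∈ Subgroup.center G := by
  have hfin : Finite G := Nat.finite_of_card_ne_zero (by rw [hG]; exact pow_ne_zero _ hp.out.ne_zero)
  obtain ⟨k, hk, hkc⟩ := IsPGroup.card_center_eq_prime_pow (p := p) hG (by norm_num)
  have hmul := (Subgroup.center G).card_mul_index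
  rw [hG, hkc] at hmul
  have hk3 : k ≤ 3 := (Nat.pow_dvd_pow_iff_le_right hp.out.one_lt).1 ⟨_, hmul.symm⟩
  have hidx : Nat.card (G ⧸ Subgroup.center G) = p ^ (3 - k) := by
    change (Subgroup.center G).index = _
    apply Nat.eq_of_mul_eq_mul_left (pow_pos hp.out.pos k)
    rw [hmul, ← pow_add, Nat.add_sub_cancel' hk3]
  have hcomm : ∀ u v : G ⧸ Subgroup.center G, u * v = v * u := by
    obtain rfl | rfl | rfl : k = 1 ∨ k = 2 ∨ k = 3 := by omega
    · have := IsPGroup.isMulCommutative_of_card_eq_prime_sq hidx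
      exact mul_comm'
    · have := isCyclic_of_prime_card (p := p) (by simpa using hidx)
      exact mul_comm'
    · have : Subsingleton (G ⧸ Subgroup.center G) :=
        (Nat.card_eq_one_iff_unique.1 (by simpa using hidx)).1
      exact fun u v => Subsingleton.elim _ _
  rw [← QuotientGroup.eq_one_iff]
  simp only [QuotientGroup.mk_mul, QuotientGroup.mk_inv]
  rw [hcomm (a : G ⧸ Subgroup.center G) b]
  group

theorem Int.dvd_sub_one_and_dvd_mul_of_pow_sub_one {p m : ℕ} (hp : p.Prime) (hodd : p ≠ 2)
    (hm : m ≠ 0) {r : ℤ} (h : (p : ℤ) ^ m ∣ r ^ p - 1) :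
    (p : ℤ) ∣ r - 1 ∧ (p : ℤ) ^ m ∣ (r - 1) * p := by
  have := Fact.mk hp
  have h1 : (p : ℤ) ∣ r - 1 := by
    have h2 : (p : ℤ) ∣ r ^ p - 1 := (dvd_pow_self _ hm).trans h
    rw [← ZMod.intCast_zmod_eq_zero_iff_dvd] at h2 ⊢
    simpa [ZMod.pow_card] using h2
  refine ⟨h1, ?_⟩
  have h3 : ¬ (p : ℤ) ∣ r := by
    intro h4
    have h5 : (p : ℤ) ∣ 1 := by simpa using dvd_sub h4 h1
    exact hp.one_lt.ne' (by exact_mod_cast Int.eq_one_of_dvd_one (by positivity) h5)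
  have h6 := Int.emultiplicity_pow_sub_pow hp (hp.odd_of_ne_two hodd) h1 h3 p
  rw [one_pow] at h6
  have hpi : Prime (p : ℤ) := Nat.prime_iff_prime_int.1 hp
  have h7 : emultiplicity (p : ℤ) ((r - 1) * p) = emultiplicity (p : ℤ) (r - 1) + emultiplicity p p := by
    rw [emultiplicity_mul hpi, Int.natCast_emultiplicity]
  rw [pow_dvd_iff_le_emultiplicity] at h ⊢
  rwa [h7, ← h6]

theorem conj_eq_mul_zpow_of_pow_commute {p m : ℕ} (hp : p.Prime) (hodd : p ≠ 2) {G : Type*}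
    [Group G] {h y : G} (hh : orderOf h = p ^ m) (hy : y * h * y⁻¹ ∈ Subgroup.zpowers h)
    (hyp : Commute (y ^ p) h) :
    ∃ k : ℤ, y * h * y⁻¹ = h ^ (p * k) * h ∧ (h ^ (p * k)) ^ p = 1 := by
  obtain ⟨r, hr⟩ := Subgroup.mem_zpowers_iff.1 hy
  rcases eq_or_ne m 0 with rfl | hm
  · have h1 : h = 1 := by simpa using hh
    exact ⟨0, by simp [h1], by simp⟩
  have hpow : ∀ i : ℕ, y ^ i * h * (y ^ i)⁻¹ = h ^ (r ^ i) := by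
    intro i
    induction i with
    | zero => simp
    | succ i ih =>
      calc y ^ (i + 1) * h * (y ^ (i + 1))⁻¹ = y ^ i * (y * h * y⁻¹) * (y ^ i)⁻¹ := by
            rw [pow_succ]; group
        _ = (y ^ i * h * (y ^ i)⁻¹) ^ r := by rw [← hr, conj_zpow]
        _ = h ^ (r ^ (i + 1)) := by rw [ih, ← zpow_mul, pow_succ]
  have h1 : h ^ (r ^ p - 1) = 1 := by
    rw [zpow_sub_one, ← hpow p, hyp.eq]; group
  have h2 : (p : ℤ) ^ m ∣ r ^ p - 1 := by
    have := orderOf_dvd_iff_zpow_eq_one.2 h1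
    rw [hh] at this; exact_mod_cast this
  obtain ⟨⟨k, hk⟩, h3⟩ := Int.dvd_sub_one_and_dvd_mul_of_pow_sub_one hp hodd hm h2
  refine ⟨k, ?_, ?_⟩
  · rw [← hk, ← zpow_add_one, sub_add_cancel, hr]
  · rw [← hk, ← zpow_natCast, ← zpow_mul, ← orderOf_dvd_iff_zpow_eq_one, hh]
    exact_mod_cast h3

theorem mem_zpowers_of_pow_prime_eq_one {p : ℕ} (hp : p.Prime) {G : Type*} [Group G]
    {h x y : G} (hx : x ∈ Subgroup.zpowers h) (hy : y ∈ Subgroup.zpowers h) (hx1 : x ≠ 1)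
    (hxp : x ^ p = 1) (hyp : y ^ p = 1) : y ∈ Subgroup.zpowers x := by
  obtain ⟨i, rfl⟩ := Subgroup.mem_zpowers_iff.1 hx
  obtain ⟨j, rfl⟩ := Subgroup.mem_zpowers_iff.1 hy
  have hpi : Prime (p : ℤ) := Nat.prime_iff_prime_int.1 hp
  have := Fact.mk hp
  obtain ⟨N, hN⟩ : p ∣ orderOf h :=
    (orderOf_eq_prime hxp hx1) ▸ orderOf_dvd_of_mem_zpowers hx
  have hdvd : ∀ {i : ℤ}, (h ^ i) ^ p = 1 → (N : ℤ) ∣ i := by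
    intro i hi
    rw [← zpow_natCast, ← zpow_mul, ← orderOf_dvd_iff_zpow_eq_one, hN, Nat.cast_mul, mul_comm i] at hi
    exact Int.dvd_of_mul_dvd_mul_left hpi.ne_zero hi
  obtain ⟨a, rfl⟩ := hdvd hxp
  obtain ⟨b, rfl⟩ := hdvd hyp
  have ha : ¬ (p : ℤ) ∣ a := by
    rintro ⟨c, rfl⟩
    apply hx1
    rw [← orderOf_dvd_iff_zpow_eq_one, hN]
    exact ⟨c, by push_cast; ring⟩
  obtain ⟨u, v, huv⟩ := (hpi.coprime_iff_not_dvd.2 ha)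
  refine Subgroup.mem_zpowers_iff.2 ⟨b * v, ?_⟩
  have hyp' : h ^ (N * b * p * u) = 1 := by
    rw [zpow_mul, zpow_mul, zpow_natCast, hyp, one_zpow]
  rw [← zpow_mul]
  calc h ^ (N * a * (b * v)) = h ^ (N * a * (b * v)) * h ^ (N * b * p * u) := by rw [hyp', mul_one]
    _ = h ^ (N * b) := by
      rw [← zpow_add]
      congr 1
      linear_combination (N * b : ℤ) * huv

theorem mul_pow_eq_of_prime_ne_two {p : ℕ} (hp : p.Prime) (hodd : p ≠ 2) {G : Type*} [Group G]
    {h c z : G} (hch : c * h = z * h * c) (hzh : Commute z h) (hzc : Commute z c)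
    (hz : z ^ p = 1) : (h * c) ^ p = h ^ p * c ^ p := by
  have hn : ∀ n : ℕ, c ^ n * h = z ^ n * h * c ^ n := by
    intro n
    induction n with
    | zero => simp
    | succ n ih =>
      rw [pow_succ, mul_assoc, hch, ← mul_assoc, ← mul_assoc, ((hzc.pow_right n).symm).eq,
        mul_assoc z, ih, pow_succ' z]
      group
  have hpow : ∀ n : ℕ, (h * c) ^ n = z ^ (n.choose 2) * h ^ n * c ^ n := by
    intro n
    induction n with
    | zero => simp
    | succ n ih =>
      rw [pow_succ, ih, Nat.choose_succ_succ' n 1, Nat.choose_one_right, pow_add]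
      calc z ^ (n.choose 2) * h ^ n * c ^ n * (h * c)
          = z ^ (n.choose 2) * h ^ n * (c ^ n * h) * c := by group
        _ = z ^ (n.choose 2) * (h ^ n * z ^ n) * (h * c ^ n) * c := by rw [hn]; group
        _ = z ^ (n.choose 2) * (z ^ n * h ^ n) * (h * c ^ n) * c := by
            rw [((hzh.pow_pow n n).symm).eq]
        _ = (z ^ (n.choose 2) * z ^ n) * (h ^ n * h) * (c ^ n * c) := by group
        _ = (z ^ n * z ^ (n.choose 2)) * h ^ (n + 1) * c ^ (n + 1) := by
            rw [← pow_add, add_comm, pow_add, pow_succ h, pow_succ c]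
  rw [hpow, Nat.choose_two_right, Nat.mul_div_assoc _ (hp.even_sub_one hodd).two_dvd, pow_mul, hz,
    one_pow, one_mul]

theorem exists_conj_of_commute_of_notMem_zpowers {p m : ℕ} [hp : Fact p.Prime] {G : Type*}
    [Group G] (hG : Nat.card G = p ^ (m + 2)) {h x : G} (hh : orderOf h = p ^ m)
    (hx : Commute x h) (hxh : x ∉ Subgroup.zpowers h)
    {α : MulAut G} (hα : α ∈ classPreservingAuts G) :
    ∃ g : G, MulAut.conj g = α := by
  have hfin : Finite G := Nat.finite_of_card_ne_zero (by rw [hG]; exact pow_ne_zero _ hp.out.ne_zero)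
  have hpG : IsPGroup p G := IsPGroup.of_card hG
  set A := Subgroup.closure {h, x}
  have hAcomm : ∀ a ∈ A, ∀ b ∈ A, Commute a b := by
    have := Subgroup.isMulCommutative_closure (k := {h, x}) (by
      rintro a (rfl | rfl) b (rfl | rfl)
      exacts [rfl, hx.symm.eq, hx.eq, rfl])
    exact fun a ha b hb => setLike_mul_comm ha hb
  have hlt : Subgroup.zpowers h < A := by
    refine lt_of_le_of_ne ?_ fun he => hxh ?_
    · rw [Subgroup.zpowers_le]
      exact Subgroup.subset_closure (by simp)
    · rw [he]
      exact Subgroup.subset_closure (by simp)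
  obtain ⟨j, hj⟩ := IsPGroup.iff_card.1 (hpG.to_subgroup A)
  have hmj : m < j := by
    by_contra! hjm
    refine hlt.ne (Subgroup.eq_of_le_of_card_ge hlt.le ?_)
    rw [hj, Nat.card_zpowers, hh]
    exact Nat.pow_le_pow_right hp.out.pos hjm
  obtain ⟨i, hi⟩ := hpG.index A
  have hij : j + i = m + 2 := by
    apply Nat.pow_right_injective hp.out.two_le
    change p ^ (j + i) = p ^ (m + 2)
    rw [← hG, ← A.card_mul_index, hj, hi, pow_add]
  obtain rfl | rfl : i = 0 ∨ i = 1 := by omega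
  · have hAtop : A = ⊤ := Subgroup.index_eq_one.1 (by simpa using hi)
    exact exists_conj_of_commute_of_pow_mem hpG A hAcomm (y := 1) (by simp)
      (fun g => ⟨g, by rw [hAtop]; trivial, 0, by simp⟩) hα
  · rw [pow_one] at hi
    have := hpG.normal_of_index_eq hi
    obtain ⟨y, hy⟩ : ∃ y, y ∉ A := by
      by_contra! hall
      rw [Subgroup.index_eq_one.2 ((Subgroup.eq_top_iff' A).2 hall)] at hi
      exact hp.out.one_lt.ne hi
    exact exists_conj_of_commute_of_pow_mem hpG A hAcomm (hi ▸ A.pow_index_mem y)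
      (exists_eq_mul_zpow_of_index_prime A hi hy) hα

theorem Subgroup.zpowers_properties_of_card_eq {p m : ℕ} [hp : Fact p.Prime] {G : Type*}
    [Group G] [Finite G] {M : Subgroup G} (hM : Nat.card M = p ^ (m + 1)) {h c : G}
    (hh : orderOf h = p ^ m) (hhM : h ∈ M) (hc : c ∈ M) (hch : c ∉ Subgroup.zpowers h) :
    c * h * c⁻¹ ∈ Subgroup.zpowers h ∧ c ^ p ∈ Subgroup.zpowers h ∧
      ∀ g ∈ M, ∃ i k : ℤ, g = h ^ i * c ^ k := by
  have hle : Subgroup.zpowers h ≤ M := by rwa [Subgroup.zpowers_le]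
  set N := (Subgroup.zpowers h).subgroupOf M
  have hidx : N.index = p := by
    have h1 := N.card_mul_index
    rw [Nat.card_congr (Subgroup.subgroupOfEquivOfLe hle).toEquiv, Nat.card_zpowers, hh, hM,
      pow_succ] at h1
    exact Nat.eq_of_mul_eq_mul_left (pow_pos hp.out.pos m) h1
  have hnorm : N.Normal := (IsPGroup.of_card hM).normal_of_index_eq hidx
  refine ⟨?_, ?_, fun g hg => ?_⟩
  · exact hnorm.conj_mem ⟨h, hhM⟩ (Subgroup.mem_zpowers h) ⟨c, hc⟩
  · have := N.pow_index_mem ⟨c, hc⟩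
    rw [hidx] at this
    exact this
  · obtain ⟨⟨n, hnM⟩, hn, k, hk⟩ := exists_eq_mul_zpow_of_index_prime N hidx
      (x := ⟨c, hc⟩) hch ⟨g, hg⟩
    obtain ⟨i, hi⟩ := Subgroup.mem_zpowers_iff.1 (show n ∈ Subgroup.zpowers h from hn)
    exact ⟨i, k, by simpa [hi] using congrArg Subtype.val hk⟩

section SelfCentralizing

variable {p m : ℕ} [hp : Fact p.Prime] {G : Type*} [Group G] [Finite G] {M : Subgroup G} {h b c : G}

theorem exists_conj_eq_of_self_centralizing (hodd : p ≠ 2)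
    (hM : Nat.card M = p ^ (m + 1)) (hh : orderOf h = p ^ m) (hhM : h ∈ M)
    (hself : ∀ x, Commute x h → x ∈ Subgroup.zpowers h)
    (hc : c ∈ M) (hch : c ∉ Subgroup.zpowers h) :
    ∃ z ∈ Subgroup.zpowers (h ^ p), z ≠ 1 ∧ z ^ p = 1 ∧ c * h * c⁻¹ = z * h ∧
      Commute c (h ^ p) := by
  obtain ⟨hconj, hcp, -⟩ := Subgroup.zpowers_properties_of_card_eq hM hh hhM hc hch
  have hcomm : Commute (c ^ p) h := by
    obtain ⟨i, hi⟩ := Subgroup.mem_zpowers_iff.1 hcp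
    rw [← hi]
    exact (Commute.refl h).zpow_left i
  obtain ⟨k, hk, hkp⟩ := conj_eq_mul_zpow_of_pow_commute hp.out hodd hh hconj hcomm
  refine ⟨_, ?_, fun h1 => hch (hself c ?_), hkp, hk, ?_⟩
  · rw [zpow_mul, zpow_natCast]
    exact Subgroup.zpow_mem_zpowers _ k
  · rw [h1, one_mul] at hk
    exact mul_inv_eq_iff_eq_mul.1 hk
  · have hcomm' : Commute (h ^ (p * k)) h := (Commute.refl h).zpow_left _
    refine mul_inv_eq_iff_eq_mul.1 ?_
    rw [← conj_pow, hk, hcomm'.mul_pow, hkp, one_mul]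

theorem exists_conj_of_conj_mem_zpowers (hodd : p ≠ 2) (hG : Nat.card G = p ^ (m + 2))
    (hM : Nat.card M = p ^ (m + 1)) (hh : orderOf h = p ^ m) (hhM : h ∈ M)
    (hself : ∀ x, Commute x h → x ∈ Subgroup.zpowers h)
    (hb : b ∉ M) (hbh : b * h * b⁻¹ ∈ Subgroup.zpowers h)
    {α : MulAut G} (hα : α ∈ classPreservingAuts G) :
    ∃ g : G, MulAut.conj g = α := by
  have hMidx : M.index = p := by
    have h1 := M.card_mul_index
    rw [hM, hG, pow_succ p (m + 1)] at h1
    exact Nat.eq_of_mul_eq_mul_left (pow_pos hp.out.pos _) h1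
  have hMn : M.Normal := (IsPGroup.of_card hG).normal_of_index_eq hMidx
  have hle : Subgroup.zpowers h ≤ M := by rwa [Subgroup.zpowers_le]
  have hbM : b ^ p ∈ M := hMidx ▸ M.pow_index_mem b
  have hbp : b ^ p ∉ Subgroup.zpowers h := by
    intro hbp
    have hcomm : Commute (b ^ p) h := by
      obtain ⟨i, hi⟩ := Subgroup.mem_zpowers_iff.1 hbp
      rw [← hi]
      exact (Commute.refl h).zpow_left i
    obtain ⟨c, hcM, hch⟩ : ∃ c ∈ M, c ∉ Subgroup.zpowers h := by
      by_contra! hall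
      have h2 := congrArg (fun K : Subgroup G => Nat.card K) (le_antisymm hle hall)
      rw [Nat.card_zpowers, hh, hM] at h2
      exact absurd (Nat.pow_right_injective hp.out.two_le h2) (by omega)
    obtain ⟨z, hz, hz1, hzp, hzc, hchp⟩ :=
      exists_conj_eq_of_self_centralizing hodd hM hh hhM hself hcM hch
    obtain ⟨k, hk, hkp⟩ := conj_eq_mul_zpow_of_pow_commute hp.out hodd hh hbh hcomm
    have hzh : z ∈ Subgroup.zpowers h :=
      Subgroup.zpowers_le.2 (Subgroup.npow_mem_zpowers h p) hz
    obtain ⟨i, hi⟩ := Subgroup.mem_zpowers_iff.1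
      (mem_zpowers_of_pow_prime_eq_one hp.out hzh (Subgroup.zpow_mem_zpowers h (p * k)) hz1 hzp hkp)
    have hzcc : Commute z c := by
      obtain ⟨j, rfl⟩ := Subgroup.mem_zpowers_iff.1 hz
      exact (hchp.zpow_right j).symm
    have hzcomm : Commute z h := by
      obtain ⟨j, rfl⟩ := Subgroup.mem_zpowers_iff.1 hzh
      exact (Commute.refl h).zpow_left j
    have hconj : h⁻¹ * c ^ i * h = z ^ i * c ^ i := by
      rw [← hzcc.mul_zpow]
      have h1 : h⁻¹ * c * h⁻¹⁻¹ = z * c := by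
        rw [inv_inv, mul_assoc, mul_inv_eq_iff_eq_mul.1 hzc, hzcomm.eq]; group
      rw [← h1, conj_zpow, inv_inv]
    have hx : Commute ((c ^ i)⁻¹ * b) h := by
      have h1 : b * h = z ^ i * h * b := by rw [hi, ← hk]; group
      have h2 : c ^ i * h = z ^ i * h * c ^ i := by
        rw [(hzcomm.zpow_left i).eq, mul_assoc h, ← hconj]; group
      calc (c ^ i)⁻¹ * b * h = (c ^ i)⁻¹ * (z ^ i * h * c ^ i) * (c ^ i)⁻¹ * b := by
            rw [mul_assoc, h1]; group
        _ = h * ((c ^ i)⁻¹ * b) := by rw [← h2]; group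
    exact hb ((M.mul_mem_cancel_left (inv_mem (zpow_mem hcM i))).1 (hle (hself _ hx)))
  obtain ⟨-, -, hfac⟩ := Subgroup.zpowers_properties_of_card_eq hM hh hhM hbM hbp
  have hprod : ∀ g : G, ∃ i k : ℤ, g = h ^ i * b ^ k := by
    intro g
    obtain ⟨n, hn, k, rfl⟩ := exists_eq_mul_zpow_of_index_prime M hMidx hb g
    obtain ⟨i, l, rfl⟩ := hfac n hn
    exact ⟨i, p * l + k, by rw [zpow_add, zpow_mul, zpow_natCast, mul_assoc]⟩
  refine exists_conj_of_closure_eq_top (a := h) (b := b) ?_ (fun g => ?_) hα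
  · rw [Subgroup.eq_top_iff']
    intro g
    obtain ⟨i, k, rfl⟩ := hprod g
    exact mul_mem (zpow_mem (Subgroup.subset_closure (by simp)) i)
      (zpow_mem (Subgroup.subset_closure (by simp)) k)
  · obtain ⟨i, k, rfl⟩ := hprod g
    exact ⟨_, _, rfl, (Commute.refl h).zpow_left i, (Commute.refl b).zpow_left k⟩

theorem exists_conj_of_conj_notMem_zpowers (hodd : p ≠ 2) (hG : Nat.card G = p ^ (m + 2))
    (hM : Nat.card M = p ^ (m + 1)) (hh : orderOf h = p ^ m) (hhM : h ∈ M)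
    (hself : ∀ x, Commute x h → x ∈ Subgroup.zpowers h)
    (hb : b ∉ M) (hbh : b * h * b⁻¹ ∉ Subgroup.zpowers h)
    {α : MulAut G} (hα : α ∈ classPreservingAuts G) :
    ∃ g : G, MulAut.conj g = α := by
  have hMidx : M.index = p := by
    have h1 := M.card_mul_index
    rw [hM, hG, pow_succ p (m + 1)] at h1
    exact Nat.eq_of_mul_eq_mul_left (pow_pos hp.out.pos _) h1
  have hMn : M.Normal := (IsPGroup.of_card hG).normal_of_index_eq hMidx
  have hbM : b ^ p ∈ M := hMidx ▸ M.pow_index_mem b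
  set c := h⁻¹ * (b * h * b⁻¹) with hcdef
  have hbc : b * h * b⁻¹ = h * c := by rw [hcdef]; group
  have hcM : c ∈ M := M.mul_mem (M.inv_mem hhM) (hMn.conj_mem h hhM b)
  have hch : c ∉ Subgroup.zpowers h := fun hc =>
    hbh (hbc ▸ mul_mem (Subgroup.mem_zpowers h) hc)
  obtain ⟨z, hz, hz1, hzp, hzc, hchp⟩ :=
    exists_conj_eq_of_self_centralizing hodd hM hh hhM hself hcM hch
  obtain ⟨-, -, hfac⟩ := Subgroup.zpowers_properties_of_card_eq hM hh hhM hcM hch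
  have hzh : z ∈ Subgroup.zpowers h := Subgroup.zpowers_le.2 (Subgroup.npow_mem_zpowers h p) hz
  have hzcomm : Commute z h := by
    obtain ⟨i, hi⟩ := Subgroup.mem_zpowers_iff.1 hzh
    rw [← hi]
    exact (Commute.refl h).zpow_left i
  set K := Subgroup.centralizer (M : Set G)
  have hKc : ∀ {x}, x ∈ K → ∀ {y}, y ∈ M → Commute x y := fun hx y hy => (hx y hy).symm
  have hhpK : h ^ p ∈ K := by
    intro y hy
    obtain ⟨i, k, rfl⟩ := hfac y hy
    exact (((Commute.refl h).pow_right p).zpow_left i).mul_left (hchp.zpow_left k)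
  have hzK : z ∈ K := Subgroup.zpowers_le.2 hhpK hz
  have hKh : K ≤ Subgroup.zpowers h := fun x hx => hself x (hKc hx hhM)
  have hm : m ≠ 0 := by
    rintro rfl
    have h1 : h = 1 := by simpa using hh
    exact hz1 (by simpa [h1] using hz)
  obtain ⟨n, rfl⟩ := Nat.exists_eq_succ_of_ne_zero hm
  have hhp : orderOf (h ^ p) = p ^ n := by
    rw [orderOf_pow_of_dvd hp.out.ne_zero (hh ▸ dvd_pow_self p hm), hh, pow_succ,
      Nat.mul_div_cancel _ hp.out.pos]
  have hK : Subgroup.zpowers (h ^ p) = K := by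
    refine Subgroup.eq_of_le_of_card_ge (Subgroup.zpowers_le.2 hhpK) ?_
    rw [Nat.card_zpowers, hhp]
    obtain ⟨j, hj⟩ := IsPGroup.iff_card.1 ((IsPGroup.of_card hG).to_subgroup K)
    rw [hj]
    refine Nat.pow_le_pow_right hp.out.pos ?_
    by_contra! hnj
    have hKeq : K = Subgroup.zpowers h := by
      refine Subgroup.eq_of_le_of_card_ge hKh ?_
      rw [Nat.card_zpowers, hh, hj]
      exact Nat.pow_le_pow_right hp.out.pos hnj
    exact hch (hself c (hKc (hKeq ▸ Subgroup.mem_zpowers h) hcM).symm)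
  have hKidx : Nat.card (G ⧸ K) = p ^ 3 := by
    have h1 := K.card_mul_index
    rw [hG, ← hK, Nat.card_zpowers, hhp] at h1
    rw [← hK]
    apply Nat.eq_of_mul_eq_mul_left (pow_pos hp.out.pos n)
    rw [← pow_add]
    exact h1
  set d := c⁻¹ * (b * c * b⁻¹) with hddef
  have hbd : b * c * b⁻¹ = c * d := by rw [hddef]; group
  have hdK : d ∈ K := by
    have h1 := Subgroup.mem_center_iff.1
      (mul_mul_inv_mul_inv_mem_center_of_card_eq_prime_cube hKidx (h : G ⧸ K)⁻¹ (b : G ⧸ K)) b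
    have h2 : (h : G ⧸ K)⁻¹ * b * (h : G ⧸ K)⁻¹⁻¹ * (b : G ⧸ K)⁻¹ = (c : G ⧸ K) := by
      rw [hcdef]
      rw [inv_inv]
      simp only [QuotientGroup.mk_mul, QuotientGroup.mk_inv, mul_assoc]
    rw [h2] at h1
    rw [← QuotientGroup.eq_one_iff, hddef]
    simp only [QuotientGroup.mk_mul, QuotientGroup.mk_inv, h1]
    group
  have hbhp : b * h ^ p * b⁻¹ ∈ Subgroup.zpowers (h ^ p) := by
    rw [hK] at *
    exact Subgroup.Normal.conj_mem inferInstance _ hhpK b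
  obtain ⟨l, hl, hlp⟩ := conj_eq_mul_zpow_of_pow_commute hp.out hodd hhp hbhp (hKc hhpK hbM).symm
  have hcp : c ^ p = (h ^ p) ^ (p * l) := by
    have h1 := mul_pow_eq_of_prime_ne_two hp.out hodd (h := h) (c := c) (z := z)
      (mul_inv_eq_iff_eq_mul.1 hzc) hzcomm (hKc hzK hcM) hzp
    rw [← hbc, conj_pow, hl, (((Commute.refl (h ^ p)).zpow_left (p * l)).eq)] at h1
    exact (mul_left_cancel h1).symm
  have hbcp : b * c ^ p * b⁻¹ = c ^ p := by
    have h1 : (c ^ p) ^ (p * l) = 1 := by rw [hcp, zpow_mul _ (p : ℤ) l, zpow_natCast, hlp, one_zpow]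
    have h2 : Commute (c ^ p) (h ^ p) := by rw [hcp]; exact (Commute.refl _).zpow_left _
    rw [← hcp] at hl
    nth_rewrite 1 [hcp]
    rw [← conj_zpow, hl, h2.mul_zpow, h1, one_mul, hcp]
  have hdp : d ^ p = 1 := by
    rw [← conj_pow, hbd, ((hKc hdK hcM).symm).mul_pow] at hbcp
    exact mul_eq_left.1 hbcp
  obtain ⟨i, hi⟩ := Subgroup.mem_zpowers_iff.1
    (mem_zpowers_of_pow_prime_eq_one hp.out hzh (hKh hdK) hz1 hzp hdp)
  set b' := h ^ i * b
  have hb'c : Commute c b' := by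
    have h1 : c * h ^ i = z ^ i * h ^ i * c := by
      rw [← hzcomm.mul_zpow, ← hzc, conj_zpow]; group
    have h2 : b * c = c * z ^ i * b := by rw [hi, ← hbd]; group
    have h3 : Commute (z ^ i) (h ^ i * c) := (hKc (zpow_mem hzK i) (mul_mem (zpow_mem hhM i) hcM))
    calc c * (h ^ i * b) = z ^ i * (h ^ i * c) * b := by rw [← mul_assoc, h1]; group
      _ = h ^ i * (c * z ^ i * b) := by rw [h3.eq]; group
      _ = h ^ i * b * c := by rw [← h2, mul_assoc]
  have hb'M : b' ∉ M := fun hmem => hb ((M.mul_mem_cancel_left (zpow_mem hhM i)).1 hmem)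
  have hprod : ∀ g : G, ∃ i k l : ℤ, g = h ^ i * (c ^ k * b' ^ l) := by
    intro g
    obtain ⟨n, hn, k, rfl⟩ := exists_eq_mul_zpow_of_index_prime M hMidx hb'M g
    obtain ⟨i, l, rfl⟩ := hfac n hn
    exact ⟨i, l, k, mul_assoc _ _ _⟩
  refine exists_conj_of_closure_eq_top (a := h) (b := b') ?_ (fun g => ?_) hα
  · rw [Subgroup.eq_top_iff']
    intro g
    obtain ⟨j, k, l, rfl⟩ := hprod g
    have hhm : h ∈ Subgroup.closure {h, b'} := Subgroup.subset_closure (by simp)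
    have hbm' : b' ∈ Subgroup.closure {h, b'} := Subgroup.subset_closure (by simp)
    have hbm : b ∈ Subgroup.closure {h, b'} :=
      (Subgroup.mul_mem_cancel_left _ (zpow_mem hhm i)).1 hbm'
    have hcm : c ∈ Subgroup.closure {h, b'} :=
      mul_mem (inv_mem hhm) (mul_mem (mul_mem hbm hhm) (inv_mem hbm))
    exact mul_mem (zpow_mem hhm j) (mul_mem (zpow_mem hcm k) (zpow_mem hbm' l))
  · obtain ⟨j, k, l, rfl⟩ := hprod g
    exact ⟨_, _, rfl, (Commute.refl h).zpow_left j,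
      (hb'c.zpow_left k).mul_left ((Commute.refl b').zpow_left l)⟩

end SelfCentralizing

theorem exists_conj_of_card_eq_of_orderOf_eq {p m : ℕ} [hp : Fact p.Prime] (hodd : p ≠ 2)
    {G : Type*} [Group G] (hG : Nat.card G = p ^ (m + 2)) {h : G} (hh : orderOf h = p ^ m)
    {α : MulAut G} (hα : α ∈ classPreservingAuts G) :
    ∃ g : G, MulAut.conj g = α := by
  have hfin : Finite G := Nat.finite_of_card_ne_zero (by rw [hG]; exact pow_ne_zero _ hp.out.ne_zero)
  by_cases hself : ∀ x, Commute x h → x ∈ Subgroup.zpowers h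
  · obtain ⟨M, hM, hle⟩ := Sylow.exists_subgroup_card_pow_succ (p := p) (n := m)
      (hG ▸ pow_dvd_pow p (Nat.le_succ _)) ((Nat.card_zpowers h).trans hh)
    have hhM : h ∈ M := hle (Subgroup.mem_zpowers h)
    obtain ⟨b, hb⟩ : ∃ b, b ∉ M := by
      by_contra! hall
      rw [(Subgroup.eq_top_iff' M).2 hall, Subgroup.card_top, hG] at hM
      exact absurd (Nat.pow_right_injective hp.out.two_le hM) (by omega)
    by_cases hbh : b * h * b⁻¹ ∈ Subgroup.zpowers h
    · exact exists_conj_of_conj_mem_zpowers hodd hG hM hh hhM hself hb hbh hα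
    · exact exists_conj_of_conj_notMem_zpowers hodd hG hM hh hhM hself hb hbh hα
  · push Not at hself
    obtain ⟨x, hx, hxh⟩ := hself
    exact exists_conj_of_commute_of_notMem_zpowers hG hh hx hxh hα

/-- For an odd prime `p`, every class preserving automorphism of a group of
order `pⁿ` having a cyclic subgroup of order `p^{n-2}` is inner. -/
theorem class_preserving_is_inner_of_cyclic_index_p_sq
    {p : ℕ} (hp : p.Prime) (hodd : p ≠ 2) {G : Type*} [Group G]
    {n : ℕ} (hcard : Nat.card G = p ^ n)
    (H : Subgroup G) (hcyc : IsCyclic H) (hH : Nat.card H = p ^ (n - 2)) :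
    classPreservingAuts G = innerAuts G := by
  have := Fact.mk hp
  refine le_antisymm (fun α hα => ?_) ?_
  · change ∃ g : G, MulAut.conj g = α
    rcases lt_or_ge n 2 with hn | hn
    · have : IsCyclic G := by
        obtain rfl | rfl : n = 0 ∨ n = 1 := by omega
        · have : Subsingleton G := (Nat.card_eq_one_iff_unique.1 (by simpa using hcard)).1
          infer_instance
        · exact isCyclic_of_prime_card (p := p) (by simpa using hcard)
      refine ⟨1, MulEquiv.ext fun x => ?_⟩
      obtain ⟨g, hg⟩ := isConj_iff.1 (hα x)
      rw [← hg, mul_comm' g x, map_one]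
      simp
    · obtain ⟨m, rfl⟩ := Nat.exists_eq_add_of_le' hn
      obtain ⟨h, hh⟩ := IsCyclic.exists_ofOrder_eq_natCard (α := H)
      exact exists_conj_of_card_eq_of_orderOf_eq hodd hcard (h := (h : G))
        (by rw [Subgroup.orderOf_coe, hh, hH, Nat.add_sub_cancel]) hα
  · rintro _ ⟨g, rfl⟩ x
    exact isConj_iff.2 ⟨g, rfl⟩
end
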